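/- arXiv:1709.09243 — 6 statements merged into one kernel-verified Lean document; each statement's English description precedes it below -/
import Mathlib

section
/- Let q be a prime power and F a finite field with q elements. For all natural numbers k ≤ n, the number of k-dimensional linear subspaces of the vector space F^n equals (q^n − 1)(q^{n−1} − 1)···(q^{n−k+1} − 1) / ((q^k − 1)(q^{k−1} − 1)···(q − 1)), i.e. the Gaussian binomial coefficient ∏_{i=0}^{k−1} (q^{n−i} − 1)/(q^{k−i} − 1). -/
theorem span_of_li_aux {F V : Type*} [Field F] [AddCommGroup V] [Module F V]
    [FiniteDimensional F V] {k : ℕ} (W : Submodule F V) (hW : Module.finrank F W = k)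
    (t : Fin k → W) (ht : LinearIndependent F t) :
    Submodule.span F (Set.range (fun i => (t i : V))) = W := by
  have h2 : LinearIndependent F (fun i => (t i : V)) :=
    ht.map' W.subtype (Submodule.ker_subtype W)
  apply Submodule.eq_of_le_of_finrank_eq
  · rw [Submodule.span_le]
    rintro _ ⟨i, rfl⟩
    exact (t i).2
  · rw [finrank_span_eq_card h2, hW, Fintype.card_fin]

theorem card_mul_aux (n k : ℕ) (F : Type*) [Field F] [Fintype F] (hkn : k ≤ n) :
    Nat.card {W : Submodule F (Fin n → F) // Module.finrank F W = k} *
      (∏ i : Fin k, (Fintype.card F ^ k - Fintype.card F ^ (i : ℕ))) =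
      ∏ i : Fin k, (Fintype.card F ^ n - Fintype.card F ^ (i : ℕ)) := by
  classical
  have h1 := card_linearIndependent (K := F) (V := Fin n → F) (k := k) (by simpa using hkn)
  rw [Module.finrank_fin_fun] at h1
  rw [← h1]
  let g : (Σ W : {W : Submodule F (Fin n → F) // Module.finrank F W = k},
      {t : Fin k → W.1 // LinearIndependent F t}) →
      {s : Fin k → (Fin n → F) // LinearIndependent F s} :=
    fun x => ⟨fun i => (x.2.1 i : Fin n → F),
      x.2.2.map' x.1.1.subtype (Submodule.ker_subtype _)⟩
  have hg : Function.Bijective g := by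
    constructor
    · rintro ⟨⟨W, hW⟩, t, ht⟩ ⟨⟨W', hW'⟩, t', ht'⟩ h
      have h' : (fun i => (t i : Fin n → F)) = fun i => (t' i : Fin n → F) :=
        congrArg Subtype.val h
      have e : W = W' := by
        rw [← span_of_li_aux W hW t ht, ← span_of_li_aux W' hW' t' ht', h']
      subst e
      have : t = t' := by
        funext i
        exact Subtype.ext (congrFun h' i)
      subst this
      rfl
    · rintro ⟨s, hs⟩
      refine ⟨⟨⟨Submodule.span F (Set.range s), ?_⟩,
        fun i => ⟨s i, Submodule.subset_span ⟨i, rfl⟩⟩, ?_⟩, rfl⟩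
      · rw [finrank_span_eq_card hs, Fintype.card_fin]
      · exact linearIndependent_span hs
  rw [← Nat.card_congr (Equiv.ofBijective g hg), Nat.card_sigma]
  have h3 : ∀ W : {W : Submodule F (Fin n → F) // Module.finrank F W = k},
      Nat.card {t : Fin k → W.1 // LinearIndependent F t} =
        ∏ i : Fin k, (Fintype.card F ^ k - Fintype.card F ^ (i : ℕ)) := fun W => by
    rw [card_linearIndependent (K := F) (V := W.1) (k := k) W.2.ge, W.2]
  rw [Finset.sum_congr rfl (fun W _ => h3 W), Finset.sum_const, Finset.card_univ,
    smul_eq_mul]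
  congr 1
  exact Nat.card_eq_fintype_card

theorem prod_aux (q n k : ℕ) (hq : 1 < q) (hkn : k ≤ n) :
    ((∏ i : Fin k, (q ^ n - q ^ (i : ℕ)) : ℕ) : ℚ) =
      (∏ i ∈ Finset.range k, (q : ℚ) ^ i) * ∏ i ∈ Finset.range k, ((q : ℚ) ^ (n - i) - 1) := by
  rw [Fin.prod_univ_eq_prod_range (fun i => q ^ n - q ^ i) k, Nat.cast_prod,
    ← Finset.prod_mul_distrib]
  refine Finset.prod_congr rfl fun i hi => ?_
  have hi : i < k := Finset.mem_range.1 hi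
  rw [Nat.cast_sub (Nat.pow_le_pow_right hq.le (by omega)), mul_sub, ← pow_add,
    Nat.add_sub_cancel' (by omega)]
  push_cast
  ring


/-- The number of `k`-dimensional linear subspaces of `F^n`, for `F` a finite field
with `q` elements (`q` a prime power), equals the Gaussian binomial coefficient
`∏_{i=0}^{k-1} (q^{n-i} - 1)/(q^{k-i} - 1)`. -/
theorem card_grassmannian_eq (q n k : ℕ) (hq : IsPrimePow q)
    (F : Type*) [Field F] [Fintype F] (hF : Fintype.card F = q) (hkn : k ≤ n) :
    (Nat.card {W : Submodule F (Fin n → F) // Module.finrank F W = k} : ℚ) =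
      ∏ i ∈ Finset.range k, (((q : ℚ) ^ (n - i) - 1) / ((q : ℚ) ^ (k - i) - 1)) := by
  have hq1 : 1 < q := hq.one_lt
  have h := card_mul_aux n k F hkn
  rw [hF] at h
  have h2 := congrArg (Nat.cast : ℕ → ℚ) h
  rw [Nat.cast_mul, prod_aux q n k hq1 hkn, prod_aux q k k hq1 le_rfl] at h2
  have hq' : (1 : ℚ) < q := by exact_mod_cast hq1
  have hA : (∏ i ∈ Finset.range k, (q : ℚ) ^ i) ≠ 0 :=
    Finset.prod_ne_zero_iff.2 fun i _ => pow_ne_zero _ (by positivity)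
  have hB : (∏ i ∈ Finset.range k, ((q : ℚ) ^ (k - i) - 1)) ≠ 0 :=
    Finset.prod_ne_zero_iff.2 fun i hi => by
      have hi : i < k := Finset.mem_range.1 hi
      have := one_lt_pow₀ hq' (n := k - i) (by omega)
      linarith
  rw [Finset.prod_div_distrib, eq_div_iff hB]
  apply mul_left_cancel₀ hA
  linarith
end

section
/- Let R be a commutative ring, π ∈ R, and let n ≥ 1 and 1 ≤ r ≤ n. Let g be the n×n diagonal matrix over R whose first r diagonal entries equal π and whose remaining n−r diagonal entries equal 1. Then for every k with 1 ≤ k ≤ n, the ideal of R generated by all k×k minors of g is the principal ideal generated by π^{max(0, k−(n−r))}; in particular it equals R for k ≤ n−r and equals (π^{k−n+r}) for k > n−r. -/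
open Matrix

/-- Let `g` be the `n × n` diagonal matrix over a commutative ring `R` whose first `r`
diagonal entries are `π` and whose remaining `n - r` entries are `1`. For `1 ≤ k ≤ n`,
the ideal of `R` generated by all `k × k` minors of `g` is the principal ideal
generated by `π ^ max 0 (k - (n - r))`; in particular it is all of `R` for `k ≤ n - r`
and equals `(π ^ (k - (n - r)))` for `k > n - r`. -/
theorem minors_ideal_of_diagonal (R : Type*) [CommRing R] (π : R) (n r : ℕ)
    (hn : 1 ≤ n) (hr1 : 1 ≤ r) (hrn : r ≤ n) (k : ℕ) (hk1 : 1 ≤ k) (hkn : k ≤ n)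
    (g : Matrix (Fin n) (Fin n) R)
    (hg : g = Matrix.diagonal (fun i : Fin n => if (i : ℕ) < r then π else 1)) :
    Ideal.span {x : R | ∃ rows cols : Fin k → Fin n, StrictMono rows ∧ StrictMono cols ∧
        x = (g.submatrix rows cols).det}
      = Ideal.span {π ^ (max 0 (k - (n - r)))} ∧
    (k ≤ n - r →
      Ideal.span {x : R | ∃ rows cols : Fin k → Fin n, StrictMono rows ∧ StrictMono cols ∧
        x = (g.submatrix rows cols).det} = ⊤) ∧
    (n - r < k →
      Ideal.span {x : R | ∃ rows cols : Fin k → Fin n, StrictMono rows ∧ StrictMono cols ∧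
        x = (g.submatrix rows cols).det} = Ideal.span {π ^ (k - (n - r))}) := by
  have key : Ideal.span {x : R | ∃ rows cols : Fin k → Fin n, StrictMono rows ∧ StrictMono cols ∧
        x = (g.submatrix rows cols).det} = Ideal.span {π ^ (k - (n - r))} := by
    apply le_antisymm
    · rw [Ideal.span_le]
      rintro x ⟨rows, cols, hrows, -, rfl⟩
      rw [SetLike.mem_coe, Ideal.mem_span_singleton]
      have h1 : g.submatrix rows cols =
          Matrix.diagonal (fun i : Fin k => if (rows i : ℕ) < r then π else 1) *
            (1 : Matrix (Fin n) (Fin n) R).submatrix rows cols := by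
        ext i j
        rw [Matrix.diagonal_mul, hg]
        simp [Matrix.diagonal_apply, Matrix.one_apply]
      rw [h1, Matrix.det_mul, Matrix.det_diagonal]
      apply Dvd.dvd.mul_right
      rw [Finset.prod_ite, Finset.prod_const, Finset.prod_const_one, mul_one]
      apply pow_dvd_pow
      have h2 : (Finset.univ.filter (fun i : Fin k => ¬ (rows i : ℕ) < r)).card
          ≤ (Finset.Ico r n).card := by
        apply Finset.card_le_card_of_injOn (fun i => (rows i : ℕ))
        · intro i hi
          have := (rows i).isLt
          simp at hi ⊢
          exact hi
        · intro i _ j _ hij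
          exact hrows.injective (Fin.ext hij)
      have h3 := Finset.card_filter_add_card_filter_not (s := (Finset.univ : Finset (Fin k)))
        (fun i : Fin k => (rows i : ℕ) < r)
      rw [Nat.card_Ico] at h2
      rw [Finset.card_univ, Fintype.card_fin] at h3
      omega
    · rw [Ideal.span_singleton_le_iff_mem]
      let f : Fin k → Fin n := fun i => ⟨i + (n - k), by omega⟩
      have hf : StrictMono f := by
        intro i j hij
        have : (i : ℕ) < j := hij
        show (i : ℕ) + (n - k) < j + (n - k)
        omega
      have h1 : (g.submatrix f f).det ∣ π ^ (k - (n - r)) := by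
        rw [hg, Matrix.submatrix_diagonal _ _ hf.injective, Matrix.det_diagonal]
        simp only [Function.comp]
        rw [Finset.prod_ite, Finset.prod_const, Finset.prod_const_one, mul_one]
        apply pow_dvd_pow
        have h2 : (Finset.univ.filter (fun i : Fin k => (f i : ℕ) < r)).card
            ≤ (Finset.range (k - (n - r))).card := by
          apply Finset.card_le_card_of_injOn (fun i : Fin k => (i : ℕ))
          · intro i hi
            simp [f] at hi ⊢
            omega
          · intro i _ j _ hij
            exact Fin.ext hij
        rwa [Finset.card_range] at h2
      exact Ideal.mem_of_dvd _ h1 (Ideal.subset_span ⟨f, f, hf, hf, rfl⟩)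
  refine ⟨?_, ?_, fun _ => key⟩
  · rw [key, Nat.zero_max]
  · intro h
    rw [key, Nat.sub_eq_zero_of_le h, pow_zero, Ideal.span_singleton_one]
end

section
/- Let 𝔽 be a finite field, and work in the ring R± = 𝔽[T, T^{-1}] of Laurent polynomials over 𝔽. Let d₁ ≥ d₂ be integers and b ∈ 𝔽 with b ≠ 0. Then there exist matrices A ∈ GL₂(R−) and B ∈ GL₂(R+) such that A · M · B = D, where M is the 2×2 matrix with rows (T^{d₁+1}, b·T^{d₁}) and (0, T^{d₂}), and D is the diagonal matrix diag(T^{d₁}, T^{d₂+1}). -/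
open Matrix LaurentPolynomial

/-- `R⁺ = 𝔽[T]`: the subring of Laurent polynomials supported in nonnegative powers. -/
noncomputable def laurentPlus (𝔽 : Type*) [Field 𝔽] : Subring (LaurentPolynomial 𝔽) :=
  (Polynomial.aeval (LaurentPolynomial.T 1) : Polynomial 𝔽 →ₐ[𝔽] LaurentPolynomial 𝔽).range.toSubring

/-- `R⁻ = 𝔽[T⁻¹]`: the subring of Laurent polynomials supported in nonpositive powers. -/
noncomputable def laurentMinus (𝔽 : Type*) [Field 𝔽] : Subring (LaurentPolynomial 𝔽) :=
  (Polynomial.aeval (LaurentPolynomial.T (-1)) : Polynomial 𝔽 →ₐ[𝔽] LaurentPolynomial 𝔽).range.toSubring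

/-- For `d₁ ≥ d₂` and `b ≠ 0`, the matrix with rows `(T^{d₁+1}, b·T^{d₁})`, `(0, T^{d₂})`
can be reduced to `diag(T^{d₁}, T^{d₂+1})` by left multiplication by an element of
`GL₂(𝔽[T⁻¹])` and right multiplication by an element of `GL₂(𝔽[T])`. -/
theorem doubleCoset_reduction_rank_two_off_diag (𝔽 : Type*) [Field 𝔽] [Fintype 𝔽]
    (d₁ d₂ : ℤ) (hd : d₂ ≤ d₁) (b : 𝔽) (hb : b ≠ 0) :
    ∃ (A : GL (Fin 2) (laurentMinus 𝔽)) (B : GL (Fin 2) (laurentPlus 𝔽)),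
      ((Matrix.GeneralLinearGroup.map (laurentMinus 𝔽).subtype A :
          GL (Fin 2) (LaurentPolynomial 𝔽)) : Matrix (Fin 2) (Fin 2) (LaurentPolynomial 𝔽)) *
        Matrix.of ![![T (d₁ + 1), C b * T d₁], ![0, T d₂]] *
        ((Matrix.GeneralLinearGroup.map (laurentPlus 𝔽).subtype B :
          GL (Fin 2) (LaurentPolynomial 𝔽)) : Matrix (Fin 2) (Fin 2) (LaurentPolynomial 𝔽))
      = Matrix.diagonal ![T d₁, T (d₂ + 1)] := by
  obtain ⟨n, hn⟩ := Int.eq_ofNat_of_zero_le (sub_nonneg.mpr hd)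
  have hCm : ∀ c : 𝔽, C c ∈ laurentMinus 𝔽 := fun c => ⟨Polynomial.C c, by simp⟩
  have hCp : ∀ c : 𝔽, C c ∈ laurentPlus 𝔽 := fun c => ⟨Polynomial.C c, by simp⟩
  have hTm : (T (d₂ - d₁) : LaurentPolynomial 𝔽) ∈ laurentMinus 𝔽 :=
    ⟨Polynomial.X ^ n, by
      have h : d₂ - d₁ = (n : ℤ) * (-1) := by omega
      simp [T_pow, h]⟩
  have hTp : (T 1 : LaurentPolynomial 𝔽) ∈ laurentPlus 𝔽 := ⟨Polynomial.X, by simp⟩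
  have hbb : (C b⁻¹ * C b : LaurentPolynomial 𝔽) = 1 := by
    rw [← map_mul, inv_mul_cancel₀ hb, map_one]
  let A : Matrix (Fin 2) (Fin 2) (laurentMinus 𝔽) :=
    !![⟨C b⁻¹, hCm _⟩, 0; ⟨T (d₂ - d₁), hTm⟩, -⟨C b, hCm b⟩]
  let B : Matrix (Fin 2) (Fin 2) (laurentPlus 𝔽) :=
    !![0, 1; 1, -(⟨C b⁻¹, hCp _⟩ * ⟨T 1, hTp⟩)]
  have hA : A.det = -1 := by
    apply Subtype.ext
    simp [A, Matrix.det_fin_two, hbb]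
  have hB : B.det = -1 := by
    simp [B, Matrix.det_fin_two]
  refine ⟨GeneralLinearGroup.mk'' A (by rw [hA]; exact isUnit_one.neg),
    GeneralLinearGroup.mk'' B (by rw [hB]; exact isUnit_one.neg), ?_⟩
  have h1 : (T (d₁ + 1) : LaurentPolynomial 𝔽) = T d₁ * T 1 := T_add _ _
  have h2 : (T (d₂ + 1) : LaurentPolynomial 𝔽) = T d₂ * T 1 := T_add _ _
  have h3 : (T (d₂ - d₁) * T d₁ : LaurentPolynomial 𝔽) = T d₂ := by
    rw [← T_add, sub_add_cancel]
  change A.map (laurentMinus 𝔽).subtype * _ * B.map (laurentPlus 𝔽).subtype = _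
  have hA' : A.map (laurentMinus 𝔽).subtype = !![C b⁻¹, 0; T (d₂ - d₁), -C b] := by
    ext1 i j
    fin_cases i <;> fin_cases j <;> rfl
  have hB' : B.map (laurentPlus 𝔽).subtype = !![0, 1; 1, -(C b⁻¹ * T 1)] := by
    ext1 i j
    fin_cases i <;> fin_cases j <;> rfl
  rw [hA', hB', h1, h2]
  clear hA' hB' hA hB
  clear A B
  generalize (C b : LaurentPolynomial 𝔽) = x at *
  generalize (C b⁻¹ : LaurentPolynomial 𝔽) = y at *
  generalize (T (d₂ - d₁) : LaurentPolynomial 𝔽) = u at *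
  ext1 i j
  fin_cases i <;> fin_cases j <;>
    simp only [Matrix.mul_apply, Fin.sum_univ_two, Matrix.of_apply, Matrix.cons_val_zero,
      Matrix.cons_val_one, Matrix.diagonal_apply, Fin.zero_eta, Fin.mk_one, Fin.isValue,
      if_true, zero_ne_one, one_ne_zero, if_false]
  · linear_combination T d₁ * hbb
  · linear_combination (-(y * T d₁ * T 1)) * hbb
  · linear_combination x * h3
  · linear_combination (T d₂ * T 1) * hbb - u * T d₁ * T 1 * hbb
end

section
/- Let 𝔽 be a finite field, and work in the ring R± = 𝔽[T, T^{-1}] of Laurent polynomials over 𝔽. Let d₁ ≥ d₂ be integers and a₁ ∈ 𝔽 with a₁ ≠ 0. Then there exist matrices A ∈ GL₂(R−) and B ∈ GL₂(R+) such that A · M · B = D, where M is the 2×2 matrix with rows (T^{d₁+2}, a₁·T^{d₁+1}) and (0, T^{d₂}), and D is the diagonal matrix diag(T^{d₁+1}, T^{d₂+1}). -/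
open Matrix LaurentPolynomial

/-- For `d₁ ≥ d₂` and `a₁ ≠ 0`, the matrix with rows `(T^{d₁+2}, a₁·T^{d₁+1})`,
`(0, T^{d₂})` can be reduced to `diag(T^{d₁+1}, T^{d₂+1})` by left multiplication by an
element of `GL₂(𝔽[T⁻¹])` and right multiplication by an element of `GL₂(𝔽[T])`. -/
theorem doubleCoset_reduction_rank_two_degree_two (𝔽 : Type*) [Field 𝔽] [Fintype 𝔽]
    (d₁ d₂ : ℤ) (hd : d₂ ≤ d₁) (a₁ : 𝔽) (ha : a₁ ≠ 0) :
    ∃ (A : GL (Fin 2) (laurentMinus 𝔽)) (B : GL (Fin 2) (laurentPlus 𝔽)),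
      ((Matrix.GeneralLinearGroup.map (laurentMinus 𝔽).subtype A :
          GL (Fin 2) (LaurentPolynomial 𝔽)) : Matrix (Fin 2) (Fin 2) (LaurentPolynomial 𝔽)) *
        Matrix.of ![![T (d₁ + 2), C a₁ * T (d₁ + 1)], ![0, T d₂]] *
        ((Matrix.GeneralLinearGroup.map (laurentPlus 𝔽).subtype B :
          GL (Fin 2) (LaurentPolynomial 𝔽)) : Matrix (Fin 2) (Fin 2) (LaurentPolynomial 𝔽))
      = Matrix.diagonal ![T (d₁ + 1), T (d₂ + 1)] := by
  obtain ⟨n, hn⟩ := Int.eq_ofNat_of_zero_le (sub_nonneg.2 hd)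
  have hC : (C a₁ * C a₁⁻¹ : LaurentPolynomial 𝔽) = 1 := by
    rw [← map_mul, mul_inv_cancel₀ ha, map_one]
  have hm : (-(C a₁⁻¹ * T (d₂ - d₁ - 1)) : LaurentPolynomial 𝔽) ∈ laurentMinus 𝔽 := by
    refine ⟨-(Polynomial.C a₁⁻¹ * Polynomial.X ^ (n + 1)), ?_⟩
    have h : d₂ - d₁ - 1 = ((n + 1 : ℕ) : ℤ) * (-1) := by push_cast; linarith
    change Polynomial.aeval (T (-1)) _ = _
    simp only [map_neg, map_mul, map_pow,
      Polynomial.aeval_X, Polynomial.aeval_C, LaurentPolynomial.T_pow, h]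
    rfl
  have hp (x : 𝔽) : (C x : LaurentPolynomial 𝔽) ∈ laurentPlus 𝔽 :=
    ⟨Polynomial.C x, by simp⟩
  have hT : (T 1 : LaurentPolynomial 𝔽) ∈ laurentPlus 𝔽 := ⟨Polynomial.X, by simp⟩
  refine ⟨Matrix.GeneralLinearGroup.mk'' !![1, 0; ⟨_, hm⟩, 1] (by simp [Matrix.det_fin_two]),
    Matrix.GeneralLinearGroup.mk'' !![0, -⟨_, hp a₁⟩; ⟨_, hp a₁⁻¹⟩, ⟨_, hT⟩] ?_, ?_⟩
  · have : Matrix.det !![0, -⟨_, hp a₁⟩; ⟨_, hp a₁⁻¹⟩, (⟨_, hT⟩ : laurentPlus 𝔽)] = 1 := by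
      rw [Matrix.det_fin_two]
      apply Subtype.ext
      simpa using hC
    rw [this]
    exact isUnit_one
  · have e1 : (T (d₁ + 2) : LaurentPolynomial 𝔽) = T (d₁ + 1) * T 1 := by
      rw [← T_add]; congr 1; ring
    have e2 : (T (d₂ + 1) : LaurentPolynomial 𝔽) = T d₂ * T 1 := T_add _ _
    have e3 : (T d₂ : LaurentPolynomial 𝔽) = T (d₂ - d₁ - 1) * T (d₁ + 1) := by
      rw [← T_add]; congr 1; ring
    change (!![1, 0; ⟨_, hm⟩, 1] : Matrix (Fin 2) (Fin 2) (laurentMinus 𝔽)).map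
      (laurentMinus 𝔽).subtype * _ * (!![0, -⟨_, hp a₁⟩; ⟨_, hp a₁⁻¹⟩, ⟨_, hT⟩] :
        Matrix (Fin 2) (Fin 2) (laurentPlus 𝔽)).map (laurentPlus 𝔽).subtype = _
    ext1 i j
    fin_cases i <;> fin_cases j <;>
      simp [Matrix.mul_apply, Fin.sum_univ_two, -T_mul] <;>
      grind
end

section
/- Let 𝔽 be a finite field, and work in the ring R± = 𝔽[T, T^{-1}] of Laurent polynomials over 𝔽. Let d₁ ≥ d₂ ≥ d₃ be integers, a ∈ 𝔽 with a ≠ 0, and b ∈ 𝔽 arbitrary. Then there exist matrices A ∈ GL₃(R−) and B ∈ GL₃(R+) such that A · M · B = D, where M is the 3×3 upper-triangular matrix with rows (T^{d₁+1}, 0, a·T^{d₁}), (0, T^{d₂+1}, b·T^{d₂}), (0, 0, T^{d₃}), and D is the diagonal matrix diag(T^{d₁}, T^{d₂+1}, T^{d₃+1}). -/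
open Matrix LaurentPolynomial

theorem coe_mk_aux {R : Type*} [CommRing R] (M : Matrix (Fin 3) (Fin 3) R) (h : IsUnit M.det) :
    ((Matrix.GeneralLinearGroup.mk'' M h : GL (Fin 3) R) : Matrix (Fin 3) (Fin 3) R) = M := rfl

theorem C_mem_plus {𝔽 : Type*} [Field 𝔽] (x : 𝔽) : (C x : LaurentPolynomial 𝔽) ∈ laurentPlus 𝔽 :=
  ⟨Polynomial.C x, by simp [LaurentPolynomial.algebraMap_apply]⟩

theorem T_mem_plus {𝔽 : Type*} [Field 𝔽] : (T 1 : LaurentPolynomial 𝔽) ∈ laurentPlus 𝔽 :=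
  ⟨Polynomial.X, by simp⟩

theorem CT_mem_minus {𝔽 : Type*} [Field 𝔽] (x : 𝔽) (n : ℤ) (hn : n ≤ 0) :
    (C x * T n : LaurentPolynomial 𝔽) ∈ laurentMinus 𝔽 := by
  obtain ⟨k, hk⟩ := Int.eq_ofNat_of_zero_le (neg_nonneg.mpr hn)
  refine ⟨Polynomial.C x * Polynomial.X ^ k, ?_⟩
  have h : n = (k : ℤ) * (-1) := by omega
  simp [LaurentPolynomial.algebraMap_apply, LaurentPolynomial.T_pow, h]

/-- For `d₁ ≥ d₂ ≥ d₃`, `a ≠ 0` and arbitrary `b`, the upper-triangular matrix with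
rows `(T^{d₁+1}, 0, a·T^{d₁})`, `(0, T^{d₂+1}, b·T^{d₂})`, `(0, 0, T^{d₃})` can be
reduced to `diag(T^{d₁}, T^{d₂+1}, T^{d₃+1})` by left multiplication by an element of
`GL₃(𝔽[T⁻¹])` and right multiplication by an element of `GL₃(𝔽[T])`. -/
theorem doubleCoset_reduction_rank_three_a_ne_zero (𝔽 : Type*) [Field 𝔽] [Fintype 𝔽]
    (d₁ d₂ d₃ : ℤ) (hd₁ : d₂ ≤ d₁) (hd₂ : d₃ ≤ d₂) (a b : 𝔽) (ha : a ≠ 0) :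
    ∃ (A : GL (Fin 3) (laurentMinus 𝔽)) (B : GL (Fin 3) (laurentPlus 𝔽)),
      ((Matrix.GeneralLinearGroup.map (laurentMinus 𝔽).subtype A :
          GL (Fin 3) (LaurentPolynomial 𝔽)) : Matrix (Fin 3) (Fin 3) (LaurentPolynomial 𝔽)) *
        Matrix.of ![![T (d₁ + 1), 0, C a * T d₁],
                    ![0, T (d₂ + 1), C b * T d₂],
                    ![0, 0, T d₃]] *
        ((Matrix.GeneralLinearGroup.map (laurentPlus 𝔽).subtype B :
          GL (Fin 3) (LaurentPolynomial 𝔽)) : Matrix (Fin 3) (Fin 3) (LaurentPolynomial 𝔽))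
      = Matrix.diagonal ![T d₁, T (d₂ + 1), T (d₃ + 1)] := by
  let p : laurentMinus 𝔽 := ⟨C (-(b * a⁻¹)) * T (d₂ - d₁), CT_mem_minus _ _ (by omega)⟩
  let q : laurentMinus 𝔽 := ⟨C (-a⁻¹) * T (d₃ - d₁), CT_mem_minus _ _ (by omega)⟩
  let ca : laurentPlus 𝔽 := ⟨C (-a), C_mem_plus _⟩
  let cb : laurentPlus 𝔽 := ⟨C (-b), C_mem_plus _⟩
  let ci : laurentPlus 𝔽 := ⟨C a⁻¹, C_mem_plus _⟩
  let t : laurentPlus 𝔽 := ⟨T 1, T_mem_plus⟩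
  have hC : (C a : LaurentPolynomial 𝔽) * C a⁻¹ = 1 := by
    rw [← map_mul, mul_inv_cancel₀ ha, map_one]
  have hB : ca * ci = -1 := by
    apply Subtype.ext
    simp [ca, ci, hC]
  refine ⟨Matrix.GeneralLinearGroup.mk'' !![1, 0, 0; p, 1, 0; q, 0, 1] ?_,
    Matrix.GeneralLinearGroup.mk'' !![0, 0, ca; 0, 1, cb; ci, 0, t] ?_, ?_⟩
  · simp [Matrix.det_fin_three]
  · simp [Matrix.det_fin_three, hB]
  · have e1 : (T (d₂ - d₁) : LaurentPolynomial 𝔽) * T d₁ = T d₂ := by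
      rw [← T_add]; congr 1; ring
    have e2 : (T (d₃ - d₁) : LaurentPolynomial 𝔽) * T d₁ = T d₃ := by
      rw [← T_add]; congr 1; ring
    ext1 i j
    fin_cases i <;> fin_cases j <;>
      simp [coe_mk_aux, Matrix.mul_apply, Fin.sum_univ_three, p, q, ca, cb, ci, t, T_add, -T_mul] <;>
      clear hB p q ca cb ci t <;> grind
end

section
/- Let 𝔽 be a finite field, and work in the ring R± = 𝔽[T, T^{-1}] of Laurent polynomials over 𝔽. Let d₁ ≥ d₂ ≥ d₃ be integers and b ∈ 𝔽 with b ≠ 0. Then there exist matrices A ∈ GL₃(R−) and B ∈ GL₃(R+) such that A · M · B = D, where M is the 3×3 upper-triangular matrix with rows (T^{d₁+1}, 0, 0), (0, T^{d₂+1}, b·T^{d₂}), (0, 0, T^{d₃}), and D is the diagonal matrix diag(T^{d₁+1}, T^{d₂}, T^{d₃+1}). -/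
open Matrix LaurentPolynomial

theorem laurentPlus_C (𝔽 : Type*) [Field 𝔽] (a : 𝔽) : (C a : LaurentPolynomial 𝔽) ∈ laurentPlus 𝔽 :=
  ⟨Polynomial.C a, by simp [LaurentPolynomial.algebraMap_apply]⟩

theorem laurentPlus_T (𝔽 : Type*) [Field 𝔽] : (T 1 : LaurentPolynomial 𝔽) ∈ laurentPlus 𝔽 :=
  ⟨Polynomial.X, by simp⟩

theorem laurentMinus_CT (𝔽 : Type*) [Field 𝔽] (a : 𝔽) (n : ℤ) (hn : n ≤ 0) :
    (C a * T n : LaurentPolynomial 𝔽) ∈ laurentMinus 𝔽 := by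
  refine ⟨Polynomial.C a * Polynomial.X ^ n.natAbs, ?_⟩
  have h : ((n.natAbs : ℕ) : ℤ) * (-1) = n := by omega
  change Polynomial.aeval (T (-1) : LaurentPolynomial 𝔽) _ = _
  rw [map_mul, map_pow, Polynomial.aeval_C, Polynomial.aeval_X, T_pow, h]
  rfl

theorem matrix_identity_aux {R : Type*} [CommRing R] (s v u t x y : R) (h : x * y = 1) :
    (!![1, 0, 0; 0, 1, 0; 0, -y * u, 1] : Matrix (Fin 3) (Fin 3) R) *
      Matrix.of ![![s, 0, 0], ![0, v * t, x * v], ![0, 0, u * v]] *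
      !![1, 0, 0; 0, 0, -x; 0, y, t] = Matrix.diagonal ![s, v, u * v * t] := by
  have h' : y * x = 1 := by rw [mul_comm, h]
  ext i j
  fin_cases i <;> fin_cases j <;>
    simp [Matrix.mul_apply, Fin.sum_univ_three, Matrix.diagonal] <;>
    grind

/-- For `d₁ ≥ d₂ ≥ d₃` and `b ≠ 0`, the upper-triangular matrix with rows
`(T^{d₁+1}, 0, 0)`, `(0, T^{d₂+1}, b·T^{d₂})`, `(0, 0, T^{d₃})` can be reduced to
`diag(T^{d₁+1}, T^{d₂}, T^{d₃+1})` by left multiplication by an element of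
`GL₃(𝔽[T⁻¹])` and right multiplication by an element of `GL₃(𝔽[T])`. -/
theorem doubleCoset_reduction_rank_three_b_ne_zero (𝔽 : Type*) [Field 𝔽] [Fintype 𝔽]
    (d₁ d₂ d₃ : ℤ) (hd₁ : d₂ ≤ d₁) (hd₂ : d₃ ≤ d₂) (b : 𝔽) (hb : b ≠ 0) :
    ∃ (A : GL (Fin 3) (laurentMinus 𝔽)) (B : GL (Fin 3) (laurentPlus 𝔽)),
      ((Matrix.GeneralLinearGroup.map (laurentMinus 𝔽).subtype A :
          GL (Fin 3) (LaurentPolynomial 𝔽)) : Matrix (Fin 3) (Fin 3) (LaurentPolynomial 𝔽)) *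
        Matrix.of ![![T (d₁ + 1), 0, 0],
                    ![0, T (d₂ + 1), C b * T d₂],
                    ![0, 0, T d₃]] *
        ((Matrix.GeneralLinearGroup.map (laurentPlus 𝔽).subtype B :
          GL (Fin 3) (LaurentPolynomial 𝔽)) : Matrix (Fin 3) (Fin 3) (LaurentPolynomial 𝔽))
      = Matrix.diagonal ![T (d₁ + 1), T d₂, T (d₃ + 1)] := by
  let c : laurentMinus 𝔽 := ⟨C (-b⁻¹) * T (d₃ - d₂), laurentMinus_CT 𝔽 _ _ (by omega)⟩
  let t : laurentPlus 𝔽 := ⟨T 1, laurentPlus_T 𝔽⟩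
  let p : laurentPlus 𝔽 := ⟨C b⁻¹, laurentPlus_C 𝔽 _⟩
  let q : laurentPlus 𝔽 := ⟨C (-b), laurentPlus_C 𝔽 _⟩
  have hbb : (C b * C b⁻¹ : LaurentPolynomial 𝔽) = 1 := by
    rw [← map_mul, mul_inv_cancel₀ hb, map_one]
  have hpq : p * q = -1 := by
    apply Subtype.ext
    change (C b⁻¹ * C (-b) : LaurentPolynomial 𝔽) = -1
    rw [map_neg, mul_neg, mul_comm, hbb]
  let A₀ : Matrix (Fin 3) (Fin 3) (laurentMinus 𝔽) := !![1, 0, 0; 0, 1, 0; 0, c, 1]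
  let B₀ : Matrix (Fin 3) (Fin 3) (laurentPlus 𝔽) := !![1, 0, 0; 0, 0, q; 0, p, t]
  have hA : A₀.det = 1 := by simp [A₀, Matrix.det_fin_three]
  have hB : B₀.det = 1 := by
    simp only [B₀, Matrix.det_fin_three]
    simp [mul_comm q p, hpq]
  refine ⟨Matrix.GeneralLinearGroup.mk'' A₀ (by rw [hA]; exact isUnit_one),
    Matrix.GeneralLinearGroup.mk'' B₀ (by rw [hB]; exact isUnit_one), ?_⟩
  have eA : ((Matrix.GeneralLinearGroup.map (laurentMinus 𝔽).subtype
      (Matrix.GeneralLinearGroup.mk'' A₀ (by rw [hA]; exact isUnit_one)) :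
      GL (Fin 3) (LaurentPolynomial 𝔽)) : Matrix (Fin 3) (Fin 3) (LaurentPolynomial 𝔽))
      = !![1, 0, 0; 0, 1, 0; 0, C (-b⁻¹) * T (d₃ - d₂), 1] := by
    ext i j
    fin_cases i <;> fin_cases j <;> rfl
  have eB : ((Matrix.GeneralLinearGroup.map (laurentPlus 𝔽).subtype
      (Matrix.GeneralLinearGroup.mk'' B₀ (by rw [hB]; exact isUnit_one)) :
      GL (Fin 3) (LaurentPolynomial 𝔽)) : Matrix (Fin 3) (Fin 3) (LaurentPolynomial 𝔽))
      = !![1, 0, 0; 0, 0, C (-b); 0, C b⁻¹, T 1] := by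
    ext i j
    fin_cases i <;> fin_cases j <;> rfl
  rw [eA, eB]
  have h1 : (T (d₂ + 1) : LaurentPolynomial 𝔽) = T d₂ * T 1 := T_add _ _
  have h2 : (T (d₃ + 1) : LaurentPolynomial 𝔽) = T d₃ * T 1 := T_add _ _
  have h3 : (T (d₃ - d₂) * T d₂ : LaurentPolynomial 𝔽) = T d₃ := by
    rw [← T_add]; congr 1; omega
  rw [h1, h2]
  rw [← h3, map_neg, map_neg]
  exact matrix_identity_aux _ _ _ _ _ _ hbb
end
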